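/- Let S_even ⊆ G be the set of codewords of even Hamming weight, and for real x let ρ(x) = [[ (1+x)/2, x/2 ], [ x/2, (1−x)/2 ]]. Then: (i) (1/2048)·[ ∑_{a,b ∈ S_even} ∏_{i=0}^{22} ρ(x)_{a(i),b(i)} + ∑_{a,b ∈ S_even} ∏_{i=0}^{22} ρ(x)_{1−a(i),1−b(i)} ] = (1 + 1012x⁸ + 2576x¹² + 8096x¹⁶)/2²²; and (ii) (1/2048)·∑_{a,b ∈ S_even} ∏_{i=0}^{22} ρ(x)_{a(i),1−b(i)} = x⁷(253 + 1288x⁴ + 8096x⁸ + 2048x¹⁶)/2²³. Consequently the output Bloch coordinate of Golay-code distillation, namely twice quantity (ii) divided by quantity (i), equals x⁷(253 + 1288x⁴ + 8096x⁸ + 2048x¹⁶)/(1 + 1012x⁸ + 2576x¹² + 8096x¹⁶) whenever the denominator in (i) is nonzero. -/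

import Mathlib

open Polynomial

/-- Hamming weight: the number of coordinates equal to 1. -/
def hw {n : ℕ} (a : Fin n → ZMod 2) : ℕ :=
  (Finset.univ.filter (fun i => a i = 1)).card

/-- The polynomial associated to a length-23 binary vector. -/
noncomputable def codePoly (c : Fin 23 → ZMod 2) : Polynomial (ZMod 2) :=
  ∑ i : Fin 23, Polynomial.C (c i) * Polynomial.X ^ (i : ℕ)

/-- The generator polynomial of the binary [23,12,7] Golay code. -/
noncomputable def golayGen : Polynomial (ZMod 2) :=
  X ^ 11 + X ^ 10 + X ^ 6 + X ^ 5 + X ^ 4 + X ^ 2 + 1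

/-- The binary cyclic [23,12,7] Golay code: vectors whose associated polynomial
is divisible by the generator polynomial modulo `X²³ - 1`. -/
def golay : Set (Fin 23 → ZMod 2) :=
  {c | ∃ q r : Polynomial (ZMod 2),
    codePoly c = golayGen * q + (X ^ 23 - 1) * r}

open scoped Classical in
/-- The even-weight Golay codewords, as a finset. -/
noncomputable def golayEven : Finset (Fin 23 → ZMod 2) :=
  Finset.univ.filter (fun c => c ∈ golay ∧ Even (hw c))

/-- Density matrix of the single-qubit state with Bloch vector `(x, 0, x)`. -/
noncomputable def rho (x : ℝ) : Matrix (ZMod 2) (ZMod 2) ℝ := fun i j =>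
  if i = 0 then (if j = 0 then (1 + x) / 2 else x / 2)
  else (if j = 0 then x / 2 else (1 - x) / 2)


/-- popcount of the lowest `n` bits -/
def popN (u n : ℕ) : ℕ :=
  Nat.rec 0 (fun n ih => Nat.add ih (Nat.mod (Nat.shiftRight u n) 2)) n

/-- pruned tree sum, natural-number version -/
def treeN (y : ℕ) (l : List ℕ) : ℕ → ℕ → ℕ → ℕ :=
  List.rec (motive := fun _ => ℕ → ℕ → ℕ → ℕ)
    (fun _ d t => cond (Nat.beq (Nat.mod (Nat.land d t) 8388608) 0)
      (Nat.pow y (popN (Nat.xor d t) 23)) 0)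
    (fun r _ ih m d t =>
      cond (Nat.beq (Nat.land (Nat.land d t) m) 0)
        (Nat.add
          (Nat.add (ih (Nat.add (Nat.add m m) 1) d t)
            (ih (Nat.add (Nat.add m m) 1) (Nat.xor d r) t))
          (Nat.add (ih (Nat.add (Nat.add m m) 1) d (Nat.xor t r))
            (ih (Nat.add (Nat.add m m) 1) (Nat.xor d r) (Nat.xor t r)))) 0) l

def rowsL : List ℕ :=
  [5279, 10558, 21116, 42232, 84464, 168928, 337856, 675712, 1351424, 2702848, 5405696]

theorem tree00 : treeN 4294967296 rowsL 0 0 0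
    = 1 + 1012 * 4294967296 ^ 8 + 2576 * 4294967296 ^ 12 + 8096 * 4294967296 ^ 16 := by
  decide +kernel

theorem tree10 : treeN 4294967296 rowsL 0 8388607 0
    = 253 * 4294967296 ^ 7 + 1288 * 4294967296 ^ 11 + 8096 * 4294967296 ^ 15
      + 2048 * 4294967296 ^ 23 := by
  decide +kernel

section Tree
variable {R : Type*} [CommSemiring R]

def wt1 (y : R) (a b : ZMod 2) : R :=
  if a = 0 then (if b = 0 then 1 else y) else (if b = 0 then y else 0)

def toVec (m : ℕ) : Fin 23 → ZMod 2 := fun i => if m.testBit i then 1 else 0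

theorem toVec_xor (m n : ℕ) : toVec (m ^^^ n) = toVec m + toVec n := by
  funext i
  simp only [toVec, Nat.testBit_xor, Pi.add_apply]
  cases m.testBit i <;> cases n.testBit i <;> decide

def Wt (y : R) (D T : Fin 23 → ZMod 2) : R := ∏ i, wt1 y (D i) (T i)

def tree (y : R) : List ℕ → ℕ → ℕ → R
  | [], d, t => Wt y (toVec d) (toVec t)
  | r :: l, d, t => (tree y l d t + tree y l (d ^^^ r) t) +
      (tree y l d (t ^^^ r) + tree y l (d ^^^ r) (t ^^^ r))

theorem map_wt1 {S : Type*} [CommSemiring S] (φ : R →+* S) (y : R) (a b : ZMod 2) :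
    φ (wt1 y a b) = wt1 (φ y) a b := by
  unfold wt1; split_ifs <;> simp

theorem map_tree {S : Type*} [CommSemiring S] (φ : R →+* S) (y : R) (l : List ℕ) :
    ∀ d t, φ (tree y l d t) = tree (φ y) l d t := by
  induction l with
  | nil => intro d t; simp [tree, Wt, map_wt1]
  | cons r l ih => intro d t; simp [tree, ih]

theorem Wt_zero (y : R) (d t : ℕ) (k : ℕ) (hk : k < 23) (h1 : d.testBit k = true)
    (h2 : t.testBit k = true) : Wt y (toVec d) (toVec t) = 0 := by
  unfold Wt
  apply Finset.prod_eq_zero (Finset.mem_univ (⟨k, hk⟩ : Fin 23))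
  simp [toVec, h1, h2, wt1]

theorem tree_zero (y : R) (l : List ℕ) (k : ℕ) (hk : k < 23)
    (hl : ∀ r ∈ l, r.testBit k = false) :
    ∀ d t : ℕ, d.testBit k = true → t.testBit k = true → tree y l d t = 0 := by
  induction l with
  | nil => intro d t h1 h2; exact Wt_zero y d t k hk h1 h2
  | cons r l ih =>
    intro d t h1 h2
    have hr := hl r (by simp)
    have ih' := ih (fun s hs => hl s (by simp [hs]))
    simp only [tree]
    rw [ih' _ _ h1 h2, ih' _ _ _ h2, ih' _ _ h1, ih' _ _] <;> simp [h1, h2, hr]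

theorem popN_succ (u n : ℕ) : popN u (n + 1) = popN u n + (u >>> n) % 2 := rfl

theorem Wt_pop (y : R) (d t : ℕ) (h : (d &&& t) % 2 ^ 23 = 0) :
    Wt y (toVec d) (toVec t) = y ^ popN (d ^^^ t) 23 := by
  have key : ∀ n, n ≤ 23 → ∏ i ∈ Finset.range n,
      wt1 y (if d.testBit i then (1 : ZMod 2) else 0) (if t.testBit i then (1 : ZMod 2) else 0)
      = y ^ popN (d ^^^ t) n := by
    intro n hn
    induction n with
    | zero => simp [popN]
    | succ n ih =>
      rw [Finset.prod_range_succ, ih (by omega), popN_succ, pow_add]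
      congr 1
      have hb : (d &&& t).testBit n = false := by
        have := congrArg (fun z => Nat.testBit z n) h
        simp only [Nat.testBit_mod_two_pow, Nat.zero_testBit] at this
        have h3 : n < 23 := by omega
        simpa [h3] using this
      have hx : ((d ^^^ t) >>> n) % 2 = ((d ^^^ t).testBit n).toNat := by
        rw [Nat.toNat_testBit, Nat.shiftRight_eq_div_pow]
      rw [hx, Nat.testBit_xor]
      rw [Nat.testBit_and] at hb
      cases h1 : d.testBit n <;> cases h2 : t.testBit n <;> simp [h1, h2, wt1] at hb ⊢
  rw [← key 23 le_rfl, Finset.prod_range]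
  rfl

def GoodL : ℕ → List ℕ → Prop
  | _, [] => True
  | m, r :: l => m < 2 ^ 23 ∧ (∀ s ∈ r :: l, s &&& m = 0) ∧ GoodL (m + m + 1) l

theorem treeN_nil (y m d t : ℕ) : treeN y [] m d t =
    cond (Nat.beq ((d &&& t) % 2 ^ 23) 0) (y ^ popN (d ^^^ t) 23) 0 := rfl

theorem treeN_cons (y r m d t : ℕ) (l : List ℕ) : treeN y (r :: l) m d t =
    cond (Nat.beq ((d &&& t) &&& m) 0)
      ((treeN y l (m + m + 1) d t + treeN y l (m + m + 1) (d ^^^ r) t) +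
      (treeN y l (m + m + 1) d (t ^^^ r) + treeN y l (m + m + 1) (d ^^^ r) (t ^^^ r))) 0 := rfl

theorem tree_eq_treeN (y : ℕ) (l : List ℕ) : ∀ m, GoodL m l → ∀ d t,
    tree y l d t = treeN y l m d t := by
  induction l with
  | nil =>
    intro m _ d t
    rw [treeN_nil]
    simp only [tree]
    cases hb : Nat.beq ((d &&& t) % 2 ^ 23) 0 with
    | true => exact Wt_pop y d t (Nat.eq_of_beq_eq_true hb)
    | false =>
      have hne := Nat.ne_of_beq_eq_false hb
      obtain ⟨k, hk⟩ := Nat.exists_testBit_of_ne_zero hne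
      simp only [Nat.testBit_mod_two_pow, Nat.testBit_and, Bool.and_eq_true,
        decide_eq_true_eq] at hk
      exact Wt_zero y d t k hk.1 hk.2.1 hk.2.2
  | cons r l ih =>
    intro m hm d t
    rw [treeN_cons]
    obtain ⟨hm1, hm2, hm3⟩ := hm
    cases hb : Nat.beq ((d &&& t) &&& m) 0 with
    | true => simp only [tree, cond_true, ih _ hm3]
    | false =>
      have hne := Nat.ne_of_beq_eq_false hb
      obtain ⟨k, hk⟩ := Nat.exists_testBit_of_ne_zero hne
      simp only [Nat.testBit_and, Bool.and_eq_true] at hk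
      have hk23 : k < 23 := by
        by_contra hcon
        have : m < 2 ^ k := lt_of_lt_of_le hm1 (Nat.pow_le_pow_right (by norm_num) (by omega))
        rw [Nat.testBit_lt_two_pow this] at hk
        simp at hk
      refine tree_zero y (r :: l) k hk23 ?_ d t hk.1.1 hk.1.2
      intro s hs
      have := congrArg (fun z => Nat.testBit z k) (hm2 s hs)
      simpa [hk.2] using this

theorem good_rows : GoodL 0 rowsL := by
  simp [GoodL, rowsL]

theorem coeff_tree (l : List ℕ) : ∀ d t n,
    (tree (X : ℕ[X]) l d t).coeff n ≤ 4 ^ l.length := by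
  induction l with
  | nil =>
    intro d t n
    simp only [tree]
    by_cases h : (d &&& t) % 2 ^ 23 = 0
    · rw [Wt_pop _ _ _ h, coeff_X_pow]; split_ifs <;> simp
    · obtain ⟨k, hk⟩ := Nat.exists_testBit_of_ne_zero h
      simp only [Nat.testBit_mod_two_pow, Nat.testBit_and, Bool.and_eq_true,
        decide_eq_true_eq] at hk
      rw [Wt_zero _ d t k hk.1 hk.2.1 hk.2.2]; simp
  | cons r l ih =>
    intro d t n
    simp only [tree, coeff_add, List.length_cons, pow_succ]
    have h1 := ih d t n
    have h2 := ih (d ^^^ r) t n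
    have h3 := ih d (t ^^^ r) n
    have h4 := ih (d ^^^ r) (t ^^^ r) n
    omega

theorem poly_eq (B : ℕ) : ∀ n (p q : ℕ[X]), (∀ k, p.coeff k < B) → (∀ k, q.coeff k < B) →
    p.eval B = q.eval B → p.coeff n = q.coeff n := by
  have ev : ∀ p : ℕ[X], p.eval B = p.divX.eval B * B + p.coeff 0 := by
    intro p
    conv_lhs => rw [← divX_mul_X_add p]
    simp
  intro n
  induction n with
  | zero =>
    intro p q hp hq h
    rw [ev p, ev q] at h
    have := congrArg (· % B) h
    simpa [Nat.mod_eq_of_lt (hp 0), Nat.mod_eq_of_lt (hq 0)] using this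
  | succ n ih =>
    intro p q hp hq h
    rw [← coeff_divX, ← coeff_divX]
    apply ih
    · intro k; rw [coeff_divX]; exact hp _
    · intro k; rw [coeff_divX]; exact hq _
    · rw [ev p, ev q] at h
      have hB : 0 < B := lt_of_le_of_lt (Nat.zero_le _) (hp 0)
      have := congrArg (· / B) h
      simpa [Nat.add_div_of_dvd_right, Nat.mul_div_cancel _ hB,
        Nat.div_eq_of_lt (hp 0), Nat.div_eq_of_lt (hq 0)] using this

theorem tree_eval (x : ℝ) (d t : ℕ) (q : ℕ[X]) (hq : ∀ k, q.coeff k < 4294967296)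
    (h : treeN 4294967296 rowsL 0 d t = q.eval 4294967296) :
    tree x rowsL d t = q.eval₂ (Nat.castRingHom ℝ) x := by
  have hp : tree (X : ℕ[X]) rowsL d t = q := by
    ext n
    apply poly_eq 4294967296 n _ _ _ hq
    · rw [← h, ← tree_eq_treeN _ _ _ good_rows]
      have := map_tree (evalRingHom (4294967296 : ℕ)) X rowsL d t
      simpa using this
    · intro k
      refine lt_of_le_of_lt (coeff_tree rowsL d t k) ?_
      simp [rowsL]
  rw [← hp]
  have := map_tree (eval₂RingHom (Nat.castRingHom ℝ) x) X rowsL d t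
  simpa using this.symm

theorem tree_x00 (x : ℝ) : tree x rowsL 0 0 =
    1 + 1012 * x ^ 8 + 2576 * x ^ 12 + 8096 * x ^ 16 := by
  rw [tree_eval x 0 0 (1 + C 1012 * X ^ 8 + C 2576 * X ^ 12 + C 8096 * X ^ 16)]
  · simp [eval₂_add, eval₂_mul, eval₂_pow]
  · intro k
    simp only [coeff_add, coeff_C_mul, coeff_X_pow, coeff_one]
    split_ifs <;> omega
  · rw [tree00]; simp

theorem tree_x10 (x : ℝ) : tree x rowsL 8388607 0 =
    253 * x ^ 7 + 1288 * x ^ 11 + 8096 * x ^ 15 + 2048 * x ^ 23 := by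
  rw [tree_eval x _ 0 (C 253 * X ^ 7 + C 1288 * X ^ 11 + C 8096 * X ^ 15 + C 2048 * X ^ 23)]
  · simp [eval₂_add, eval₂_mul, eval₂_pow]
  · intro k
    simp only [coeff_add, coeff_C_mul, coeff_X_pow]
    split_ifs <;> omega
  · rw [tree10]; simp

end Tree

/-- generator rows -/
def Em : Matrix (Fin 11) (Fin 23) (ZMod 2) := fun j => toVec (5279 <<< (j : ℕ))

def Um : Matrix (Fin 23) (Fin 11) (ZMod 2) := fun i j =>
  if Nat.testBit ([739, 1478, 908, 1816, 1584, 1120, 192, 384, 768, 1536, 1024].getD i 0) j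
  then 1 else 0

def Wm : Matrix (Fin 11) (Fin 23) (ZMod 2) := fun i j =>
  if Nat.testBit ([4673536, 7145472, 8316928, 5842944, 1484800, 6946816, 3647488, 2621440,
    5242880, 4433920, 2336768].getD i 0) j then 1 else 0

def enc (u : Fin 11 → ZMod 2) : Fin 23 → ZMod 2 := Matrix.vecMul u Em

theorem mat1 : ∀ i k : Fin 23, (if i = k then (1 : ZMod 2) else 0) =
    ∑ j, Um i j * Em j k + ∑ j, Em j i * Wm j k + toVec 6531072 k := by decide +kernel

theorem mat2 : ∀ i k : Fin 11, ∑ j, Em i j * Um j k = if i = k then 1 else 0 := by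
  decide +kernel

theorem mat3 : ∀ i k : Fin 11, ∑ j, Em i j * Em k j = 0 := by decide +kernel

theorem mat4 : ∀ i : Fin 11, ∑ j, Em i j = 0 := by decide +kernel

theorem enc_add (u v) : enc (u + v) = enc u + enc v := Matrix.add_vecMul _ _ _

theorem enc_sum (u) : ∑ i, enc u i = 0 := by
  simp only [enc, Matrix.vecMul, dotProduct]
  rw [Finset.sum_comm]
  simp [← Finset.mul_sum, mat4]

theorem enc_orth (u) (j : Fin 11) : ∑ i, enc u i * Em j i = 0 := by
  simp only [enc, Matrix.vecMul, dotProduct, Finset.sum_mul]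
  rw [Finset.sum_comm]
  simp [mul_assoc, ← Finset.mul_sum, mat3]

theorem enc_orth2 (u v) : ∑ i, enc u i * enc v i = 0 := by
  have : ∀ i, enc v i = ∑ j, v j * Em j i := fun i => rfl
  simp only [this, Finset.mul_sum]
  rw [Finset.sum_comm]
  apply Finset.sum_eq_zero
  intro j _
  have h := enc_orth u j
  calc _ = ∑ i, v j * (enc u i * Em j i) := Finset.sum_congr rfl (fun i _ => by ring)
    _ = 0 := by rw [← Finset.mul_sum, h, mul_zero]

theorem dec_enc (u) : Matrix.vecMul (enc u) Um = u := by
  have : Em * Um = 1 := by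
    ext i k; rw [Matrix.mul_apply, mat2, Matrix.one_apply]
  rw [enc, Matrix.vecMul_vecMul, this, Matrix.vecMul_one]

theorem enc_dec (c : Fin 23 → ZMod 2) (h1 : ∑ i, c i = 0) (h2 : ∀ j, ∑ i, c i * Em j i = 0) :
    enc (Matrix.vecMul c Um) = c := by
  funext k
  have h : c k = ∑ i, c i * (if i = k then (1 : ZMod 2) else 0) := by simp
  rw [h]
  simp only [mat1, mul_add, Finset.sum_add_distrib]
  have a1 : ∑ i, c i * toVec 6531072 k = 0 := by rw [← Finset.sum_mul, h1, zero_mul]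
  have a2 : ∑ i, c i * ∑ j, Em j i * Wm j k = 0 := by
    simp only [Finset.mul_sum]
    rw [Finset.sum_comm]
    apply Finset.sum_eq_zero
    intro j _
    simp only [← mul_assoc]
    rw [← Finset.sum_mul, h2, zero_mul]
  rw [a1, a2, add_zero, add_zero, enc, Matrix.vecMul_vecMul]
  rfl

theorem enc_inj : Function.Injective enc := fun u v h => by
  rw [← dec_enc u, h, dec_enc]

theorem coeff_codePoly (c : Fin 23 → ZMod 2) (n : ℕ) :
    (codePoly c).coeff n = if h : n < 23 then c ⟨n, h⟩ else 0 := by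
  simp only [codePoly, finsetSum_coeff, coeff_C_mul, coeff_X_pow]
  split_ifs with h
  · rw [Finset.sum_eq_single (⟨n, h⟩ : Fin 23)]
    · simp
    · intro b _ hb
      have : n ≠ b := fun e => hb (Fin.ext e.symm)
      simp [this]
    · simp
  · apply Finset.sum_eq_zero
    intro i _
    have : n ≠ i := by have := i.2; omega
    simp [this]

theorem codePoly_inj : Function.Injective codePoly := fun a b h => by
  funext i
  have := congrArg (fun p => p.coeff (i : ℕ)) h
  simpa [coeff_codePoly] using this

noncomputable def fPoly : (ZMod 2)[X] :=
  X ^ 12 + X ^ 10 + X ^ 7 + X ^ 4 + X ^ 3 + X ^ 2 + X + 1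

theorem two_poly : (2 : (ZMod 2)[X]) = 0 := by
  have : (C (2 : ZMod 2)) = (0 : (ZMod 2)[X]) := by
    rw [show (2 : ZMod 2) = 0 from rfl, C_0]
  rw [← this]; exact (map_ofNat C 2).symm

theorem fPoly_eq : fPoly = (X - 1) * golayGen := by
  unfold fPoly golayGen
  linear_combination ((1) * X ^ 10 + (1) * X ^ 4 + (1) * X ^ 2 + (1) * X ^ 0) * two_poly

theorem fPoly_coeff (n : ℕ) : fPoly.coeff n = if Nat.testBit 5279 n then 1 else 0 := by
  by_cases h : n < 13
  · interval_cases n <;> simp [fPoly, coeff_X_pow, coeff_X, coeff_one, Nat.testBit] 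
  · have : Nat.testBit 5279 n = false := by
      apply Nat.testBit_lt_two_pow
      calc 5279 < 2 ^ 13 := by norm_num
        _ ≤ 2 ^ n := Nat.pow_le_pow_right (by norm_num) (by omega)
    rw [this]
    simp only [fPoly, coeff_add, coeff_X_pow, coeff_X, coeff_one]
    repeat rw [if_neg (by omega)]
    simp

theorem codePoly_row (j : Fin 11) : codePoly (Em j) = X ^ (j : ℕ) * fPoly := by
  ext n
  rw [coeff_codePoly, coeff_X_pow_mul', fPoly_coeff]
  have hj := j.2
  split_ifs with h1 h2 h3 h3 h3
  all_goals simp_all [Em, toVec, Nat.testBit_shiftLeft]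
  have hf : Nat.testBit 5279 (n - j) = false := by
    apply Nat.testBit_lt_two_pow
    calc 5279 < 2 ^ 13 := by norm_num
        _ ≤ 2 ^ (n - j) := Nat.pow_le_pow_right (by norm_num) (by omega)
  simp_all

theorem codePoly_enc (u : Fin 11 → ZMod 2) :
    codePoly (enc u) = fPoly * ∑ j : Fin 11, C (u j) * X ^ (j : ℕ) := by
  have : codePoly (enc u) = ∑ j, C (u j) * codePoly (Em j) := by
    simp only [codePoly, enc, Matrix.vecMul, dotProduct, map_sum, map_mul, Finset.sum_mul,
      Finset.mul_sum]
    rw [Finset.sum_comm]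
    simp only [mul_assoc]
  rw [this, Finset.mul_sum]
  refine Finset.sum_congr rfl (fun j _ => ?_)
  rw [codePoly_row]; ring

theorem even_hw (c : Fin 23 → ZMod 2) : Even (hw c) ↔ ∑ i, c i = 0 := by
  rw [← ZMod.natCast_eq_zero_iff_even]
  have : ((hw c : ℕ) : ZMod 2) = ∑ i, c i := by
    rw [hw, Finset.card_filter]
    push_cast
    refine Finset.sum_congr rfl (fun i _ => ?_)
    generalize c i = z
    revert z; decide
  rw [this]

theorem eval_codePoly (c : Fin 23 → ZMod 2) : (codePoly c).eval 1 = ∑ i, c i := by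
  simp [codePoly, eval_finsetSum]

theorem gen_dvd : golayGen ∣ (X ^ 23 - 1 : (ZMod 2)[X]) := by
  refine ⟨X ^ 12 + X ^ 11 + X ^ 10 + X ^ 9 + X ^ 8 + X ^ 5 + X ^ 2 + X ^ 0, ?_⟩
  unfold golayGen
  linear_combination ((-1) * X ^ 0 + (-1) * X ^ 22 + (-1) * X ^ 21 + (-1) * X ^ 20 + (-1) * X ^ 19 + (-2) * X ^ 16 + (-2) * X ^ 13 + (-2) * X ^ 11 + (-1) * X ^ 18 + (-2) * X ^ 15 + (-2) * X ^ 12 + (-2) * X ^ 10 + (-1) * X ^ 17 + (-2) * X ^ 14 + (-1) * X ^ 8 + (-1) * X ^ 6 + (-1) * X ^ 7 + (-1) * X ^ 5 + (-1) * X ^ 9 + (-1) * X ^ 4 + (-1) * X ^ 2) * two_poly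

theorem mem_golayEven (c : Fin 23 → ZMod 2) : c ∈ golayEven ↔ ∃ u, enc u = c := by
  simp only [golayEven, Finset.mem_filter, Finset.mem_univ, true_and, even_hw]
  constructor
  · rintro ⟨⟨q, r, hqr⟩, hs⟩
    have hg : golayGen ∣ codePoly c := by
      rw [hqr]
      exact dvd_add (dvd_mul_right _ _) (dvd_mul_of_dvd_left gen_dvd _)
    have hx : (X - 1 : (ZMod 2)[X]) ∣ codePoly c := by
      rw [show (X - 1 : (ZMod 2)[X]) = X - C 1 by simp, dvd_iff_isRoot, IsRoot, eval_codePoly, hs]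
    have hco : IsCoprime (X - 1 : (ZMod 2)[X]) golayGen := by
      have h1 : (X - 1 : (ZMod 2)[X]) ∣ golayGen - 1 := by
        rw [show (X - 1 : (ZMod 2)[X]) = X - C 1 by simp, dvd_iff_isRoot, IsRoot]
        simp [golayGen]
        decide
      obtain ⟨s, hs⟩ := h1
      exact ⟨-s, 1, by linear_combination hs⟩
    have hf : fPoly ∣ codePoly c := by
      rw [fPoly_eq]; exact hco.mul_dvd hx hg
    obtain ⟨q, hq⟩ := hf
    have hfm : fPoly.Monic := by
      unfold fPoly; monicity!
    have hfd : fPoly.natDegree = 12 := by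
      unfold fPoly; compute_degree!
    have hqd : q.natDegree < 11 := by
      by_cases hq0 : q = 0
      · simp [hq0]
      have h1 : (codePoly c).natDegree = 12 + q.natDegree := by
        rw [hq, hfm.natDegree_mul' hq0, hfd]
      have h2 : (codePoly c).natDegree ≤ 22 := by
        rw [natDegree_le_iff_coeff_eq_zero]
        intro n hn
        rw [coeff_codePoly, dif_neg (by omega)]
      omega
    refine ⟨fun j => q.coeff j, codePoly_inj ?_⟩
    have hqs : q = ∑ j : Fin 11, C (q.coeff j) * X ^ (j : ℕ) := by
      have := q.as_sum_range_C_mul_X_pow' hqd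
      rwa [Finset.sum_range] at this
    rw [codePoly_enc, hq, ← hqs]
  · rintro ⟨u, rfl⟩
    refine ⟨⟨(X - 1) * ∑ j : Fin 11, C (u j) * X ^ (j : ℕ), 0, ?_⟩, enc_sum u⟩
    rw [codePoly_enc, fPoly_eq]; ring

def chi (z : ZMod 2) : ℝ := if z = 0 then 1 else -1

theorem chi_add (a b : ZMod 2) : chi (a + b) = chi a * chi b := by
  have h : ∀ a : ZMod 2, a = 0 ∨ a = 1 := by decide
  have h11 : (1 + 1 : ZMod 2) = 0 := by decide
  rcases h a with rfl | rfl <;> rcases h b with rfl | rfl <;> simp [chi, h11]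

theorem chi_sum {ι : Type*} (s : Finset ι) (f : ι → ZMod 2) :
    chi (∑ i ∈ s, f i) = ∏ i ∈ s, chi (f i) := by
  classical
  induction s using Finset.induction_on with
  | empty => simp [chi]
  | insert a s ha ih => rw [Finset.sum_insert ha, Finset.prod_insert ha, chi_add, ih]

theorem sum_zmod2 {M : Type*} [AddCommMonoid M] (f : ZMod 2 → M) : ∑ z, f z = f 0 + f 1 :=
  Fin.sum_univ_two f

theorem rho_eq (x : ℝ) (a d : ZMod 2) :
    rho x a (a + d) = (1 / 2) * ∑ t : ZMod 2, wt1 x d t * chi (a * t) := by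
  have h : ∀ a : ZMod 2, a = 0 ∨ a = 1 := by decide
  have h11 : (1 + 1 : ZMod 2) = 0 := by decide
  rw [sum_zmod2]
  rcases h a with rfl | rfl <;> rcases h d with rfl | rfl <;> simp [chi, h11, rho, wt1] <;> ring

theorem prod_rho (x : ℝ) (a D : Fin 23 → ZMod 2) :
    ∏ i, rho x (a i) (a i + D i) =
      (1 / 2) ^ 23 * ∑ T : Fin 23 → ZMod 2, Wt x D T * chi (∑ i, a i * T i) := by
  simp only [rho_eq, Finset.prod_mul_distrib, Finset.prod_const, Finset.card_univ,
    Fintype.card_fin]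
  congr 1
  rw [Fintype.prod_sum]
  refine Finset.sum_congr rfl (fun T _ => ?_)
  rw [Finset.prod_mul_distrib, chi_sum, Wt]

theorem chi_enc (T : Fin 23 → ZMod 2) :
    ∑ u, chi (∑ i, enc u i * T i) = if ∀ j, ∑ i, T i * Em j i = 0 then 2048 else 0 := by
  have h1 : ∀ u, ∑ i, enc u i * T i = ∑ j, u j * ∑ i, T i * Em j i := by
    intro u
    simp only [enc, Matrix.vecMul, dotProduct, Finset.sum_mul, Finset.mul_sum]
    rw [Finset.sum_comm]
    exact Finset.sum_congr rfl fun i _ => Finset.sum_congr rfl fun j _ => by ring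
  simp only [h1, chi_sum]
  rw [← Fintype.prod_sum (fun (j : Fin 11) (z : ZMod 2) => chi (z * ∑ i, T i * Em j i))]
  have h2 : ∀ s : ZMod 2, ∑ z : ZMod 2, chi (z * s) = if s = 0 then 2 else 0 := by
    intro s
    rw [sum_zmod2]
    by_cases hs : s = 0 <;> simp [chi, hs]; norm_num
  simp only [h2]
  split_ifs with h
  · simp [h]; norm_num
  · push Not at h
    obtain ⟨j, hj⟩ := h
    exact Finset.prod_eq_zero (Finset.mem_univ j) (by simp [hj])

theorem sum_dual (F : (Fin 23 → ZMod 2) → ℝ) :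
    ∑ T, F T * (if ∀ j, ∑ i, T i * Em j i = 0 then 2048 else 0) =
      2048 * ∑ w, (F (enc w) + F (enc w + 1)) := by
  have h1 : ∀ w, F (enc w) + F (enc w + 1) = ∑ s : ZMod 2, F (enc w + fun _ => s) := by
    intro w
    rw [sum_zmod2]
    congr 2
    funext i; simp
  simp only [h1, mul_ite, mul_zero]
  rw [← Finset.sum_filter, ← Fintype.sum_prod_type', Finset.mul_sum]
  symm
  have h23 : (23 : ZMod 2) = 1 := by decide
  have hz : ∀ s : ZMod 2, s + s = 0 := by decide
  refine Finset.sum_bij'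
    (fun p _ => enc p.1 + fun _ => p.2)
    (fun T _ => (Matrix.vecMul (T + fun _ => ∑ i, T i) Um, ∑ i, T i)) ?_ ?_ ?_ ?_ ?_
  · rintro ⟨w, s⟩ _
    simp only [Finset.mem_filter, Finset.mem_univ, true_and, Pi.add_apply, add_mul,
      Finset.sum_add_distrib, enc_orth, ← Finset.mul_sum, mat4]
    simp
  · simp
  · rintro ⟨w, s⟩ _
    have hs : ∑ i, (enc w + fun _ => s : Fin 23 → ZMod 2) i = s := by
      simp only [Pi.add_apply, Finset.sum_add_distrib, enc_sum]
      simp [h23]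
    simp only [hs]
    have : (enc w + (fun _ => s)) + (fun _ => s) = enc w := by
      funext i; simp [add_assoc, hz]
    rw [this, dec_enc]
  · intro T hT
    simp only [Finset.mem_filter, Finset.mem_univ, true_and] at hT
    rw [enc_dec]
    · funext i; simp [add_assoc, hz]
    · simp only [Pi.add_apply, Finset.sum_add_distrib]
      simp [h23, hz]
    · intro j
      simp only [Pi.add_apply, add_mul, Finset.sum_add_distrib, hT, ← Finset.mul_sum, mat4]
      simp
  · intro p _
    ring

theorem sum_golayEven (F : (Fin 23 → ZMod 2) → ℝ) : ∑ a ∈ golayEven, F a = ∑ u, F (enc u) := by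
  symm
  refine Finset.sum_bij (fun u _ => enc u) ?_ ?_ ?_ ?_
  · intro u _; exact (mem_golayEven _).2 ⟨u, rfl⟩
  · intro u _ v _ h; exact enc_inj h
  · intro c hc
    obtain ⟨u, hu⟩ := (mem_golayEven c).1 hc
    exact ⟨u, Finset.mem_univ _, hu⟩
  · intros; rfl

/-- The master computation: `a` is shifted by the constant `p`, `b` by `p + q`. -/
theorem master (x : ℝ) (p q : ZMod 2) :
    ∑ a ∈ golayEven, ∑ b ∈ golayEven, ∏ i, rho x (a i + p) ((a i + p) + ((a i + b i) + q)) =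
    (1 / 2) ^ 23 * (2048 * ∑ v, ∑ w,
      (Wt x (enc v + fun _ => q) (enc w) + chi p * Wt x (enc v + fun _ => q) (enc w + 1))) := by
  simp only [sum_golayEven]
  have hz : ∀ s t : ZMod 2, s + (s + t) = t := by decide
  have h1 : ∀ u, ∑ v, ∏ i, rho x (enc u i + p) ((enc u i + p) + ((enc u i + enc v i) + q)) =
      ∑ v, ∏ i, rho x (enc u i + p) ((enc u i + p) + (enc v + fun _ => q : Fin 23 → ZMod 2) i) := by
    intro u
    rw [← Equiv.sum_comp (Equiv.addLeft u)]
    refine Finset.sum_congr rfl fun v _ => Finset.prod_congr rfl fun i _ => ?_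
    simp [enc_add, hz]
  simp only [h1]
  rw [Finset.sum_comm]
  have h2 : ∀ v, ∑ u, ∏ i, rho x (enc u i + p) ((enc u i + p) + (enc v + fun _ => q : Fin 23 → ZMod 2) i) =
      (1 / 2) ^ 23 * (2048 * ∑ w,
      (Wt x (enc v + fun _ => q) (enc w) + chi p * Wt x (enc v + fun _ => q) (enc w + 1))) := by
    intro v
    have h3 : ∀ u, ∏ i, rho x (enc u i + p) ((enc u i + p) + (enc v + fun _ => q : Fin 23 → ZMod 2) i) =
        (1 / 2) ^ 23 * ∑ T, (Wt x (enc v + fun _ => q) T * chi (p * ∑ i, T i)) *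
          chi (∑ i, enc u i * T i) := by
      intro u
      rw [prod_rho x (fun i => enc u i + p)]
      congr 1
      refine Finset.sum_congr rfl fun T _ => ?_
      simp only [add_mul, Finset.sum_add_distrib, chi_add, ← Finset.mul_sum]
      ring
    simp only [h3]
    rw [← Finset.mul_sum, Finset.sum_comm]
    simp only [← Finset.mul_sum, chi_enc]
    rw [sum_dual]
    congr 2
    refine Finset.sum_congr rfl fun w _ => ?_
    have h23 : (23 : ZMod 2) = 1 := by decide
    have e1 : ∑ i, (enc w + 1) i = 1 := by
      simp only [Pi.add_apply, Finset.sum_add_distrib, enc_sum]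
      simp [h23]
    rw [enc_sum, e1, mul_zero, mul_one]
    simp [chi, mul_comm]
  simp only [h2]
  rw [← Finset.mul_sum, ← Finset.mul_sum]

theorem Wt_odd (x : ℝ) (v w) : Wt x (enc v + fun _ => 1) (enc w + 1) = 0 := by
  have h23 : (23 : ZMod 2) = 1 := by decide
  have h : ∑ i, (enc v + fun _ => 1 : Fin 23 → ZMod 2) i * (enc w + 1) i = 1 := by
    simp only [Pi.add_apply, add_mul, mul_add, Finset.sum_add_distrib, enc_orth2, one_mul,
      Pi.one_apply, mul_one, enc_sum]
    simp [h23]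
  obtain ⟨i, _, hi⟩ := Finset.exists_ne_zero_of_sum_ne_zero (h.trans_ne one_ne_zero)
  apply Finset.prod_eq_zero (Finset.mem_univ i)
  have := mul_ne_zero_iff.1 hi
  simp only [wt1, this.1, this.2, if_false]

theorem tree_sum (x : ℝ) : ∀ (n : ℕ) (r : Fin n → ℕ) (d t : ℕ),
    tree x (List.ofFn r) d t = ∑ v : Fin n → ZMod 2, ∑ w : Fin n → ZMod 2,
      Wt x (toVec d + ∑ j, v j • toVec (r j)) (toVec t + ∑ j, w j • toVec (r j)) := by
  intro n
  induction n with
  | zero => intro r d t; simp [tree]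
  | succ n ih =>
    intro r d t
    have hs : ∀ F : (Fin (n + 1) → ZMod 2) → ℝ, ∑ v, F v =
        ∑ v : Fin n → ZMod 2, F (Fin.cons 0 v) + ∑ v : Fin n → ZMod 2, F (Fin.cons 1 v) := by
      intro F
      rw [← Equiv.sum_comp (Fin.consEquiv (fun _ => ZMod 2)), Fintype.sum_prod_type, sum_zmod2]
      rfl
    rw [List.ofFn_succ]
    simp only [tree, ih, hs, Fin.sum_univ_succ, Fin.cons_zero, Fin.cons_succ, zero_smul,
      one_smul, zero_add, toVec_xor, Finset.sum_add_distrib, add_assoc]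
    ring

theorem rows_eq : rowsL = List.ofFn (fun j : Fin 11 => 5279 <<< (j : ℕ)) := by decide

theorem tree_enc (x : ℝ) (d t : ℕ) : tree x rowsL d t =
    ∑ v, ∑ w, Wt x (toVec d + enc v) (toVec t + enc w) := by
  have h : ∀ v, enc v = ∑ j, v j • toVec (5279 <<< (j : ℕ)) := by
    intro v; funext i
    simp [enc, Matrix.vecMul, dotProduct, Em]
  rw [rows_eq, tree_sum]
  simp only [h]

theorem toVec_zero : toVec 0 = 0 := by funext i; simp [toVec]
theorem toVec_ones : toVec 8388607 = fun _ => 1 := by decide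

theorem val00 (x : ℝ) : ∑ v, ∑ w, Wt x (enc v) (enc w) =
    1 + 1012 * x ^ 8 + 2576 * x ^ 12 + 8096 * x ^ 16 := by
  rw [← tree_x00, tree_enc]; simp [toVec_zero]

theorem val10 (x : ℝ) : ∑ v, ∑ w, Wt x (enc v + fun _ => 1) (enc w) =
    253 * x ^ 7 + 1288 * x ^ 11 + 8096 * x ^ 15 + 2048 * x ^ 23 := by
  rw [← tree_x10, tree_enc]; simp [toVec_zero, toVec_ones, add_comm]

theorem part1 (x : ℝ) : (1 / 2048 : ℝ) *
        ((∑ a ∈ golayEven, ∑ b ∈ golayEven, ∏ i : Fin 23, rho x (a i) (b i)) +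
         (∑ a ∈ golayEven, ∑ b ∈ golayEven,
            ∏ i : Fin 23, rho x (1 - a i) (1 - b i))) =
      (1 + 1012 * x ^ 8 + 2576 * x ^ 12 + 8096 * x ^ 16) / 2 ^ 22 := by
  have m0 := master x 0 0
  have m1 := master x 1 0
  have e0 : ∀ a b : ZMod 2, (a + 0) + ((a + b) + 0) = b := by decide
  have e1 : ∀ a b : ZMod 2, (a + 1) + ((a + b) + 0) = 1 - b := by decide
  have e2 : ∀ a : ZMod 2, a + 1 = 1 - a := by decide
  have ez : (fun _ => 0 : Fin 23 → ZMod 2) = 0 := rfl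
  have c0 : chi 0 = 1 := by simp [chi]
  have c1 : chi 1 = -1 := by simp [chi]
  simp only [e0] at m0
  simp only [e1] at m1
  simp only [e2] at m1
  simp only [add_zero] at m0
  rw [m0, m1, ← val00 x, ez, c0, c1]
  simp only [Finset.sum_add_distrib, ← Finset.mul_sum, add_zero]
  ring

theorem part2 (x : ℝ) : (1 / 2048 : ℝ) *
        (∑ a ∈ golayEven, ∑ b ∈ golayEven, ∏ i : Fin 23, rho x (a i) (1 - b i)) =
      x ^ 7 * (253 + 1288 * x ^ 4 + 8096 * x ^ 8 + 2048 * x ^ 16) / 2 ^ 23 := by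
  have m0 := master x 0 1
  have e0 : ∀ a b : ZMod 2, (a + 0) + ((a + b) + 1) = 1 - b := by decide
  simp only [e0] at m0
  simp only [add_zero] at m0
  rw [m0]
  simp only [Wt_odd, mul_zero, add_zero, val10]
  ring

theorem stmt_14 (x : ℝ) :
    ((1 / 2048 : ℝ) *
        ((∑ a ∈ golayEven, ∑ b ∈ golayEven, ∏ i : Fin 23, rho x (a i) (b i)) +
         (∑ a ∈ golayEven, ∑ b ∈ golayEven,
            ∏ i : Fin 23, rho x (1 - a i) (1 - b i))) =
      (1 + 1012 * x ^ 8 + 2576 * x ^ 12 + 8096 * x ^ 16) / 2 ^ 22) ∧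
    ((1 / 2048 : ℝ) *
        (∑ a ∈ golayEven, ∑ b ∈ golayEven, ∏ i : Fin 23, rho x (a i) (1 - b i)) =
      x ^ 7 * (253 + 1288 * x ^ 4 + 8096 * x ^ 8 + 2048 * x ^ 16) / 2 ^ 23) ∧
    (1 + 1012 * x ^ 8 + 2576 * x ^ 12 + 8096 * x ^ 16 ≠ 0 →
      2 * ((1 / 2048 : ℝ) *
            (∑ a ∈ golayEven, ∑ b ∈ golayEven,
              ∏ i : Fin 23, rho x (a i) (1 - b i))) /
          ((1 / 2048 : ℝ) *
            ((∑ a ∈ golayEven, ∑ b ∈ golayEven, ∏ i : Fin 23, rho x (a i) (b i)) +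
             (∑ a ∈ golayEven, ∑ b ∈ golayEven,
                ∏ i : Fin 23, rho x (1 - a i) (1 - b i)))) =
        x ^ 7 * (253 + 1288 * x ^ 4 + 8096 * x ^ 8 + 2048 * x ^ 16) /
          (1 + 1012 * x ^ 8 + 2576 * x ^ 12 + 8096 * x ^ 16)) := by

  refine ⟨part1 x, part2 x, fun h => ?_⟩
  rw [part1, part2]
  field_simp
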